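/- arXiv:2012.04168 — 8 statements merged into one kernel-verified Lean document; each statement's English description precedes it below -/
import Mathlib

section
/- Let I ⊆ ℝ be an open interval containing the origin, let φ : I → ℝ be differentiable with φ(0) = φ₀ and φ'(0) ≠ 0, and let R : U → ℝ be a differentiable function on an open set U ⊆ ℝ² that is an explicit addition formula for φ, i.e. φ(t+τ) = R(φ(t), φ(τ)) for all t, τ ∈ I with t + τ ∈ I. Then for every τ ∈ I, the first partial derivative of R at (φ₀, φ(τ)) equals the second partial derivative of R at (φ(τ), φ₀): R_x(φ₀, φ(τ)) = R_y(φ(τ), φ₀). Moreover φ'(τ) = R_x(φ₀, φ(τ))·φ'(0) and φ'(τ) = R_y(φ(τ), φ₀)·φ'(0) for all τ ∈ I. -/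
/-- If `φ (τ + t) = F (φ t)` for `t` near `0`, the chain rule gives `deriv φ τ` in terms of `deriv F (φ 0)`. -/
theorem deriv_eq_mul_of_eventually_add_eq {φ F : ℝ → ℝ} {τ : ℝ}
    (hφ : DifferentiableAt ℝ φ 0) (hF : DifferentiableAt ℝ F (φ 0))
    (h : ∀ᶠ t in nhds 0, φ (τ + t) = F (φ t)) :
    deriv φ τ = deriv F (φ 0) * deriv φ 0 := by
  calc deriv φ τ = deriv (fun t => φ (τ + t)) 0 := by rw [deriv_comp_const_add, add_zero]
    _ = deriv (F ∘ φ) 0 := Filter.EventuallyEq.deriv_eq h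
    _ = deriv F (φ 0) * deriv φ 0 := deriv_comp 0 hF hφ

/-- **Necessary condition (iii): equality of cross partial derivatives at `φ₀`.**
Let `I = (a,b)` be an open interval containing the origin, `φ : I → ℝ` differentiable with
`φ(0) = φ₀` and `φ'(0) ≠ 0`, and let `R : U → ℝ` be differentiable on an open `U ⊆ ℝ²` and
an explicit addition formula for `φ` (with `(φ(t), φ(τ)) ∈ U` whenever `t, τ, t+τ ∈ I`).
Then for every `τ ∈ I`: `R_x(φ₀, φ(τ)) = R_y(φ(τ), φ₀)`, and moreover
`φ'(τ) = R_x(φ₀, φ(τ))·φ'(0)` and `φ'(τ) = R_y(φ(τ), φ₀)·φ'(0)`. -/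
theorem addition_formula_cross_partials (a b : ℝ) (h0 : (0 : ℝ) ∈ Set.Ioo a b)
    (φ : ℝ → ℝ) (φ₀ : ℝ)
    (hφ : ∀ t ∈ Set.Ioo a b, DifferentiableAt ℝ φ t)
    (hφ0 : φ 0 = φ₀) (hd0 : deriv φ 0 ≠ 0)
    (U : Set (ℝ × ℝ)) (hU : IsOpen U)
    (R : ℝ × ℝ → ℝ) (hR : DifferentiableOn ℝ R U)
    (hmem : ∀ t ∈ Set.Ioo a b, ∀ τ ∈ Set.Ioo a b, t + τ ∈ Set.Ioo a b → (φ t, φ τ) ∈ U)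
    (hadd : ∀ t ∈ Set.Ioo a b, ∀ τ ∈ Set.Ioo a b, t + τ ∈ Set.Ioo a b →
      φ (t + τ) = R (φ t, φ τ)) :
    ∀ τ ∈ Set.Ioo a b,
      deriv (fun u => R (u, φ τ)) φ₀ = deriv (fun v => R (φ τ, v)) φ₀ ∧
      deriv φ τ = deriv (fun u => R (u, φ τ)) φ₀ * deriv φ 0 ∧
      deriv φ τ = deriv (fun v => R (φ τ, v)) φ₀ * deriv φ 0 := by
  subst hφ0
  intro τ hτ
  have hdiff {p : ℝ × ℝ} (hp : p ∈ U) : DifferentiableAt ℝ R p :=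
    hR.differentiableAt (hU.mem_nhds hp)
  have hev : ∀ᶠ t in nhds (0 : ℝ), t ∈ Set.Ioo a b ∧ τ + t ∈ Set.Ioo a b := by
    refine (isOpen_Ioo.eventually_mem h0).and ?_
    have hcont : ContinuousAt (fun t : ℝ => τ + t) 0 := by fun_prop
    exact hcont.eventually_mem (isOpen_Ioo.mem_nhds (by simpa using hτ))
  have hx : deriv φ τ = deriv (fun u => R (u, φ τ)) (φ 0) * deriv φ 0 := by
    refine deriv_eq_mul_of_eventually_add_eq (hφ 0 h0) ?_ ?_
    · exact (hdiff (hmem 0 h0 τ hτ (by simpa using hτ))).comp (φ 0)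
        (differentiableAt_id.prodMk (differentiableAt_const _))
    · filter_upwards [hev] with t ht
      rw [add_comm τ t] at ht ⊢
      exact hadd t ht.1 τ hτ ht.2
  have hy : deriv φ τ = deriv (fun v => R (φ τ, v)) (φ 0) * deriv φ 0 := by
    refine deriv_eq_mul_of_eventually_add_eq (hφ 0 h0) ?_ ?_
    · exact (hdiff (hmem τ hτ 0 h0 (by simpa using hτ))).comp (φ 0)
        ((differentiableAt_const _).prodMk differentiableAt_id)
    · filter_upwards [hev] with t ht
      exact hadd τ hτ t ht.1 ht.2
  exact ⟨mul_right_cancel₀ hd0 (hx.symm.trans hy), hx, hy⟩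
end

section
/- Let I ⊆ ℝ be an open interval containing the origin, let φ : I → ℝ be differentiable with φ(0) = φ₀, and let R : U → ℝ be a differentiable function on an open set U ⊆ ℝ² that is an explicit addition formula for φ. Then φ is a solution of the autonomous initial value problem φ'(t) = R_x(φ₀, φ(t))·φ'(0) for all t ∈ I, with φ(0) = φ₀; equivalently, φ'(t) = R_y(φ(t), φ₀)·φ'(0) for all t ∈ I. -/
/-- If `φ (t + τ) = f (φ τ)` for small `τ`, then the derivative of `φ` at `t` is given by the chain
rule applied to `f ∘ φ` at `0`. -/
theorem hasDerivAt_of_eventually_add_eq {φ f : ℝ → ℝ} {t : ℝ}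
    (hφt : DifferentiableAt ℝ φ t) (hφ0 : DifferentiableAt ℝ φ 0)
    (hf : DifferentiableAt ℝ f (φ 0)) (h : ∀ᶠ τ in nhds 0, φ (t + τ) = f (φ τ)) :
    HasDerivAt φ (deriv f (φ 0) * deriv φ 0) t := by
  have hcomp : HasDerivAt (fun τ => φ (t + τ)) (deriv f (φ 0) * deriv φ 0) 0 :=
    (hf.hasDerivAt.comp 0 hφ0.hasDerivAt).congr_of_eventuallyEq h
  have hshift : HasDerivAt (fun τ => φ (t + τ)) (deriv φ t) 0 :=
    HasDerivAt.comp_const_add t 0 (by simpa using hφt.hasDerivAt)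
  rw [hcomp.unique hshift]
  exact hφt.hasDerivAt

/-- **A function with an addition formula solves an autonomous first order ODE.**
Let `I = (a,b)` be an open interval containing the origin, `φ : I → ℝ` differentiable with
`φ(0) = φ₀`, and `R : U → ℝ` a differentiable function on an open `U ⊆ ℝ²` that is an
explicit addition formula for `φ`.  Then `φ` solves the autonomous initial value problem
`φ'(t) = R_x(φ₀, φ(t))·φ'(0)` on `I` with `φ(0) = φ₀`; equivalently,
`φ'(t) = R_y(φ(t), φ₀)·φ'(0)` on `I`. -/
theorem addition_formula_gives_ode (a b : ℝ) (h0 : (0 : ℝ) ∈ Set.Ioo a b)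
    (φ : ℝ → ℝ) (φ₀ : ℝ)
    (hφ : ∀ t ∈ Set.Ioo a b, DifferentiableAt ℝ φ t)
    (hφ0 : φ 0 = φ₀)
    (U : Set (ℝ × ℝ)) (hU : IsOpen U)
    (R : ℝ × ℝ → ℝ) (hR : DifferentiableOn ℝ R U)
    (hmem : ∀ t ∈ Set.Ioo a b, ∀ τ ∈ Set.Ioo a b, t + τ ∈ Set.Ioo a b → (φ t, φ τ) ∈ U)
    (hadd : ∀ t ∈ Set.Ioo a b, ∀ τ ∈ Set.Ioo a b, t + τ ∈ Set.Ioo a b →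
      φ (t + τ) = R (φ t, φ τ)) :
    φ 0 = φ₀ ∧
    ∀ t ∈ Set.Ioo a b,
      HasDerivAt φ (deriv (fun u => R (u, φ t)) φ₀ * deriv φ 0) t ∧
      HasDerivAt φ (deriv (fun v => R (φ t, v)) φ₀ * deriv φ 0) t := by
  subst hφ0
  refine ⟨rfl, fun t ht => ?_⟩
  have hnear : ∀ᶠ τ in nhds (0 : ℝ), τ ∈ Set.Ioo a b ∧ t + τ ∈ Set.Ioo a b := by
    refine (isOpen_Ioo.eventually_mem h0).and ?_
    have hcont : ContinuousAt (fun τ : ℝ => t + τ) 0 := by fun_prop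
    exact hcont.eventually_mem (isOpen_Ioo.mem_nhds (by simpa using ht))
  have hdiff {p : ℝ × ℝ} (hp : p ∈ U) : DifferentiableAt ℝ R p :=
    hR.differentiableAt (hU.mem_nhds hp)
  constructor
  · refine hasDerivAt_of_eventually_add_eq (hφ t ht) (hφ 0 h0) ?_ ?_
    · exact (hdiff (hmem 0 h0 t ht (by simpa using ht))).comp (φ 0)
        (differentiableAt_id.prodMk (differentiableAt_const (φ t)))
    · filter_upwards [hnear] with τ ⟨hτ, htτ⟩
      rw [add_comm] at htτ ⊢
      exact hadd τ hτ t ht htτ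
  · refine hasDerivAt_of_eventually_add_eq (hφ t ht) (hφ 0 h0) ?_ ?_
    · exact (hdiff (hmem t ht 0 h0 (by simpa using ht))).comp (φ 0)
        ((differentiableAt_const (φ t)).prodMk differentiableAt_id)
    · filter_upwards [hnear] with τ ⟨hτ, htτ⟩
      exact hadd t ht τ hτ htτ
end

section
/- Let R : ℝ² → ℝ be a C² symmetric function, and suppose there exists x₀ ∈ ℝ such that: (i) R(x₀, y) = y and R(x, x₀) = x for all x, y; (ii) R_x(x₀, z) = R_y(z, x₀) for all z, and denote this common value f(z) = R_x(x₀, z); (iii) R_x(a,b)·R_x(x₀,a) = R_x(x₀, R(a,b)) and R_y(a,b)·R_y(b,x₀) = R_y(R(a,b), x₀) for all a, b. Let x : I → ℝ be the solution, on an interval I containing 0, of the initial value problem x'(t) = f(x(t)), x(0) = x₀. Then R is an explicit addition formula for x: for all t, τ ∈ I with t + τ ∈ I, x(t+τ) = R(x(t), x(τ)). -/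
open Set

/-- Two solutions of the autonomous ODE `γ' = v γ` with `v` locally Lipschitz that agree at one
endpoint of a closed interval agree at the other endpoint. -/
theorem eq_of_hasDerivAt_of_locallyLipschitz {E : Type*} [NormedAddCommGroup E] [NormedSpace ℝ E]
    {v : E → E} (hv : LocallyLipschitz v) {f g : ℝ → E} {a b : ℝ}
    (hf : ∀ t ∈ uIcc a b, HasDerivAt f (v (f t)) t)
    (hg : ∀ t ∈ uIcc a b, HasDerivAt g (v (g t)) t) (hab : f a = g a) : f b = g b := by
  have hfc : ContinuousOn f (uIcc a b) := fun t ht => (hf t ht).continuousAt.continuousWithinAt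
  have hgc : ContinuousOn g (uIcc a b) := fun t ht => (hg t ht).continuousAt.continuousWithinAt
  obtain ⟨K, hK⟩ := hv.locallyLipschitzOn.exists_lipschitzOnWith_of_compact
    ((isCompact_uIcc.image_of_continuousOn hfc).union (isCompact_uIcc.image_of_continuousOn hgc))
  rcases le_total a b with h | h
  · rw [uIcc_of_le h] at *
    exact ODE_solution_unique_of_mem_Icc_right (v := fun _ => v) (fun _ _ => hK) hfc
      (fun t ht => (hf t (Ico_subset_Icc_self ht)).hasDerivWithinAt)
      (fun t ht => .inl (mem_image_of_mem f (Ico_subset_Icc_self ht))) hgc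
      (fun t ht => (hg t (Ico_subset_Icc_self ht)).hasDerivWithinAt)
      (fun t ht => .inr (mem_image_of_mem g (Ico_subset_Icc_self ht))) hab (right_mem_Icc.2 h)
  · rw [uIcc_of_ge h] at *
    exact ODE_solution_unique_of_mem_Icc_left (v := fun _ => v) (fun _ _ => hK) hfc
      (fun t ht => (hf t (Ioc_subset_Icc_self ht)).hasDerivWithinAt)
      (fun t ht => .inl (mem_image_of_mem f (Ioc_subset_Icc_self ht))) hgc
      (fun t ht => (hg t (Ioc_subset_Icc_self ht)).hasDerivWithinAt)
      (fun t ht => .inr (mem_image_of_mem g (Ioc_subset_Icc_self ht))) hab (left_mem_Icc.2 h)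

/-- The partial derivative of a differentiable function on a product in its first argument. -/
theorem Differentiable.hasDerivAt_prodMk_left {R : ℝ × ℝ → ℝ} (hR : Differentiable ℝ R) (p q : ℝ) :
    HasDerivAt (fun u => R (u, q)) (fderiv ℝ R (p, q) (1, 0)) p :=
  (hR (p, q)).hasFDerivAt.comp_hasDerivAt p ((hasDerivAt_id p).prodMk (hasDerivAt_const p q))


/-- **Sufficient conditions for a bivariate function to be an addition formula.**
Let `R : ℝ² → ℝ` be a `C²` symmetric function and `x₀ ∈ ℝ` such that
(i) `R(x₀,y) = y` and `R(x,x₀) = x`;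
(ii) `R_x(x₀,z) = R_y(z,x₀)` for all `z` (write `f(z) = R_x(x₀,z)`);
(iii) `R_x(a,b)·R_x(x₀,a) = R_x(x₀,R(a,b))` and `R_y(a,b)·R_y(b,x₀) = R_y(R(a,b),x₀)`.
If `x : I → ℝ` solves `x' = f(x)`, `x(0) = x₀` on an interval `I` containing `0`, then
`R` is an explicit addition formula for `x`:
`x(t+τ) = R(x(t), x(τ))` for all `t, τ ∈ I` with `t+τ ∈ I`. -/
theorem addition_formula_sufficient (R : ℝ × ℝ → ℝ) (hR : ContDiff ℝ 2 R)
    (hsym : ∀ p q : ℝ, R (p, q) = R (q, p))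
    (x₀ : ℝ)
    (hid₁ : ∀ q : ℝ, R (x₀, q) = q) (hid₂ : ∀ p : ℝ, R (p, x₀) = p)
    (hcross : ∀ z : ℝ, deriv (fun u => R (u, z)) x₀ = deriv (fun v => R (z, v)) x₀)
    (hcomp₁ : ∀ p q : ℝ,
      deriv (fun u => R (u, q)) p * deriv (fun u => R (u, p)) x₀
        = deriv (fun u => R (u, R (p, q))) x₀)
    (hcomp₂ : ∀ p q : ℝ,
      deriv (fun v => R (p, v)) q * deriv (fun v => R (q, v)) x₀
        = deriv (fun v => R (R (p, q), v)) x₀)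
    (I : Set ℝ) (hI : I.OrdConnected) (h0 : (0 : ℝ) ∈ I)
    (x : ℝ → ℝ)
    (hx : ∀ t ∈ I, HasDerivAt x (deriv (fun u => R (u, x t)) x₀) t)
    (hx0 : x 0 = x₀) :
    ∀ t ∈ I, ∀ τ ∈ I, t + τ ∈ I → x (t + τ) = R (x t, x τ) := by
  have hdiff : Differentiable ℝ R := hR.differentiable two_ne_zero
  have hlip : LocallyLipschitz fun z => deriv (fun u => R (u, z)) x₀ := by
    simp_rw [fun z => (hdiff.hasDerivAt_prodMk_left x₀ z).deriv]
    have hR' : ContDiff ℝ 1 (fderiv ℝ R) := hR.fderiv_right (by norm_num)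
    exact ((hR'.comp (contDiff_const.prodMk contDiff_id)).clm_apply contDiff_const).locallyLipschitz
  intro t ht τ hτ htτ
  refine eq_of_hasDerivAt_of_locallyLipschitz hlip (a := 0) (f := fun s => x (s + τ))
    (g := fun s => R (x s, x τ)) (fun s hs => ?_) (fun s hs => ?_) (by simp [hx0, hid₁])
  · have hsτ : s + τ ∈ uIcc τ (t + τ) := by
      simpa using mem_image_of_mem (· + τ) hs
    exact (hx _ (hI.uIcc_subset hτ htτ hsτ)).comp_add_const s τ
  · have hp := hdiff.hasDerivAt_prodMk_left (x s) (x τ)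
    rw [← hcomp₁, hp.deriv]
    exact hp.comp s (hx s (hI.uIcc_subset h0 ht hs))
end

section
/- Let R : ℝ² → ℝ be a C² function and x₀ ∈ ℝ such that R(x₀,x₀) = x₀, R_x(x₀, z) = R_y(z, x₀) for all z, and R_x(a,b)·R_x(x₀,a) = R_x(x₀, R(a,b)) and R_y(a,b)·R_y(b,x₀) = R_y(R(a,b), x₀) for all a, b. Let x : I → ℝ solve x'(t) = R_x(x₀, x(t)) with x(0) = x₀ on an interval I containing 0, and fix α, β ∈ ℝ. Then the function ψ(t) := R(x(tα), x(tβ)), defined for t with tα, tβ ∈ I, satisfies the initial value problem ψ'(t) = (α+β)·R_x(x₀, ψ(t)), ψ(0) = x₀. -/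
/-- **Key computation in the sufficiency proof.**
Let `R : ℝ² → ℝ` be `C²` and `x₀ ∈ ℝ` with `R(x₀,x₀) = x₀`, `R_x(x₀,z) = R_y(z,x₀)`
for all `z`, and `R_x(a,b)·R_x(x₀,a) = R_x(x₀,R(a,b))`,
`R_y(a,b)·R_y(b,x₀) = R_y(R(a,b),x₀)` for all `a, b`.  If `x : I → ℝ` solves
`x'(t) = R_x(x₀, x(t))`, `x(0) = x₀` on an interval `I ∋ 0`, and `α, β ∈ ℝ`, then
`ψ(t) := R(x(tα), x(tβ))` satisfies `ψ(0) = x₀` and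
`ψ'(t) = (α+β)·R_x(x₀, ψ(t))` for every `t` with `tα, tβ ∈ I`. -/
theorem duplication_auxiliary_ivp (R : ℝ × ℝ → ℝ) (hR : ContDiff ℝ 2 R)
    (x₀ : ℝ) (hid : R (x₀, x₀) = x₀)
    (hcross : ∀ z : ℝ, deriv (fun u => R (u, z)) x₀ = deriv (fun v => R (z, v)) x₀)
    (hcomp₁ : ∀ p q : ℝ,
      deriv (fun u => R (u, q)) p * deriv (fun u => R (u, p)) x₀
        = deriv (fun u => R (u, R (p, q))) x₀)
    (hcomp₂ : ∀ p q : ℝ,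
      deriv (fun v => R (p, v)) q * deriv (fun v => R (q, v)) x₀
        = deriv (fun v => R (R (p, q), v)) x₀)
    (I : Set ℝ) (h0 : (0 : ℝ) ∈ I)
    (x : ℝ → ℝ)
    (hx : ∀ t ∈ I, HasDerivAt x (deriv (fun u => R (u, x t)) x₀) t)
    (hx0 : x 0 = x₀) (α β : ℝ) :
    R (x (0 * α), x (0 * β)) = x₀ ∧
    ∀ t : ℝ, t * α ∈ I → t * β ∈ I →
      HasDerivAt (fun s => R (x (s * α), x (s * β)))
        ((α + β) * deriv (fun u => R (u, R (x (t * α), x (t * β)))) x₀) t := by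
  refine ⟨by simpa [hx0] using hid, fun t hα hβ => ?_⟩
  set p := x (t * α) with hp
  set q := x (t * β) with hq
  have hF : HasFDerivAt R (fderiv ℝ R (p, q)) (p, q) :=
    (hR.differentiable (by norm_num) (p, q)).hasFDerivAt
  have hfst : deriv (fun u => R (u, q)) p = fderiv ℝ R (p, q) (1, 0) :=
    (hF.comp_hasDerivAt p ((hasDerivAt_id p).prodMk (hasDerivAt_const p q))).deriv
  have hsnd : deriv (fun v => R (p, v)) q = fderiv ℝ R (p, q) (0, 1) :=
    (hF.comp_hasDerivAt q ((hasDerivAt_const q p).prodMk (hasDerivAt_id q))).deriv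
  have hxα := (hx _ hα).comp t (hasDerivAt_mul_const α)
  have hxβ := (hx _ hβ).comp t (hasDerivAt_mul_const β)
  refine (hF.comp_hasDerivAt t (hxα.prodMk hxβ)).congr_deriv ?_
  rw [← hp, ← hq]
  have hsplit : ∀ a b : ℝ, fderiv ℝ R (p, q) (a, b)
      = a * fderiv ℝ R (p, q) (1, 0) + b * fderiv ℝ R (p, q) (0, 1) := by
    intro a b
    rw [← smul_eq_mul, ← smul_eq_mul, ← map_smul, ← map_smul, ← map_add]
    simp
  have h₁ := hcomp₁ p q
  have h₂ := hcomp₂ p q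
  rw [← hcross, ← hcross] at h₂
  rw [hsplit, ← hfst, ← hsnd]
  linear_combination α * h₁ + β * h₂
end

section
/- Fix n ∈ ℕ, n ≥ 1, and x₀ > 0. Let I ⊆ ℝ be an interval containing 0 and let x : I → ℝ be a differentiable positive function satisfying x'(t) = x(t)^{n+1} for all t ∈ I and x(0) = x₀. Then for all t, τ ∈ I with t + τ ∈ I such that x₀ⁿ(x(t)ⁿ + x(τ)ⁿ) − x(t)ⁿ·x(τ)ⁿ > 0, one has the explicit addition formula x(t+τ) = x₀·x(t)·x(τ) / (x₀ⁿ(x(t)ⁿ + x(τ)ⁿ) − x(t)ⁿ·x(τ)ⁿ)^{1/n}. -/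
/-- Along a positive solution of `x' = x ^ (n + 1)`, the function `x⁻ⁿ` is affine with slope `-n`. -/
lemma inv_pow_eq_of_hasDerivAt_pow {n : ℕ} (hn : 1 ≤ n) {I : Set ℝ} (hI : I.OrdConnected)
    (h0 : (0 : ℝ) ∈ I) {x : ℝ → ℝ} (hpos : ∀ t ∈ I, 0 < x t)
    (hx : ∀ t ∈ I, HasDerivAt x (x t ^ (n + 1)) t) {t : ℝ} (ht : t ∈ I) :
    (x t ^ n)⁻¹ = (x 0 ^ n)⁻¹ - n * t := by
  have hderiv : ∀ s ∈ I, HasDerivWithinAt (fun s => (x s ^ n)⁻¹ + n * s) 0 I s := by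
    intro s hs
    have hne : x s ≠ 0 := (hpos s hs).ne'
    have h := (((hx s hs).pow n).inv (pow_ne_zero n hne)).add ((hasDerivAt_id s).const_mul (n : ℝ))
    refine (h.congr_deriv ?_).hasDerivWithinAt
    obtain ⟨m, rfl⟩ := Nat.exists_eq_add_of_le' hn
    simp only [Pi.pow_apply, Nat.add_sub_cancel]
    field_simp
    ring
  have h := hI.convex.norm_image_sub_le_of_norm_hasDerivWithin_le (C := 0) hderiv
    (by simp) h0 ht
  rw [zero_mul, norm_le_zero_iff] at h
  linarith

/-- **Explicit addition formula for `x' = x^{n+1}`.**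
Fix `n ≥ 1` and `x₀ > 0`.  If `x : I → ℝ` is a differentiable positive function on an
interval `I ∋ 0` with `x'(t) = x(t)^{n+1}` and `x(0) = x₀`, then for all `t, τ ∈ I` with
`t + τ ∈ I` and `x₀ⁿ(x(t)ⁿ + x(τ)ⁿ) − x(t)ⁿ x(τ)ⁿ > 0`,
`x(t+τ) = x₀ x(t) x(τ) / (x₀ⁿ(x(t)ⁿ + x(τ)ⁿ) − x(t)ⁿ x(τ)ⁿ)^{1/n}`. -/
theorem addition_formula_power_ode (n : ℕ) (hn : 1 ≤ n) (x₀ : ℝ) (hx₀ : 0 < x₀)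
    (I : Set ℝ) (hI : I.OrdConnected) (h0 : (0 : ℝ) ∈ I)
    (x : ℝ → ℝ) (hpos : ∀ t ∈ I, 0 < x t)
    (hx : ∀ t ∈ I, HasDerivAt x (x t ^ (n + 1)) t)
    (hx0 : x 0 = x₀) :
    ∀ t ∈ I, ∀ τ ∈ I, t + τ ∈ I →
      0 < x₀ ^ n * (x t ^ n + x τ ^ n) - x t ^ n * x τ ^ n →
      x (t + τ) =
        x₀ * x t * x τ /
          (x₀ ^ n * (x t ^ n + x τ ^ n) - x t ^ n * x τ ^ n) ^ ((1 : ℝ) / n) := by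
  intro t ht τ hτ htτ hD
  have hxt := hpos t ht
  have hxτ := hpos τ hτ
  have hxs := hpos _ htτ
  have et := inv_pow_eq_of_hasDerivAt_pow hn hI h0 hpos hx ht
  have eτ := inv_pow_eq_of_hasDerivAt_pow hn hI h0 hpos hx hτ
  have es := inv_pow_eq_of_hasDerivAt_pow hn hI h0 hpos hx htτ
  rw [hx0] at et eτ es
  have key : (x (t + τ) ^ n)⁻¹ = (x t ^ n)⁻¹ + (x τ ^ n)⁻¹ - (x₀ ^ n)⁻¹ := by
    rw [et, eτ, es]
    ring
  rw [eq_div_iff (Real.rpow_pos_of_pos hD _).ne']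
  refine (pow_left_inj₀ (by positivity) (by positivity) (Nat.one_le_iff_ne_zero.mp hn)).mp ?_
  rw [mul_pow, mul_pow, mul_pow, one_div,
    Real.rpow_inv_natCast_pow hD.le (Nat.one_le_iff_ne_zero.mp hn)]
  field_simp at key
  linarith
end

section
/- Fix n ∈ ℕ, n ≥ 1, and x₀ > 0. Let I ⊆ ℝ be an interval containing 0 and let x : I → ℝ be a differentiable positive function satisfying x'(t) = x(t)^{1/(n+1)} for all t ∈ I and x(0) = x₀. Then for all t, τ ∈ I with t + τ ∈ I one has the explicit addition formula x(t+τ) = ( x(t)^{n/(n+1)} − x₀^{n/(n+1)} + x(τ)^{n/(n+1)} )^{(n+1)/n}. -/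
/-- On an order-connected set containing `0`, a function with constant derivative `c` is affine. -/
theorem eq_add_mul_of_hasDerivAt_const {s : Set ℝ} (hs : s.OrdConnected) (h0 : (0 : ℝ) ∈ s)
    {y : ℝ → ℝ} {c : ℝ} (hy : ∀ t ∈ s, HasDerivAt y c t) {t : ℝ} (ht : t ∈ s) :
    y t = y 0 + c * t := by
  have hderiv : ∀ u ∈ s, HasDerivWithinAt (fun u => y u - c * u) 0 s u := fun u hu =>
    (((hy u hu).sub ((hasDerivAt_id u).const_mul c)).congr_deriv (by simp)).hasDerivWithinAt
  have h := hs.convex.norm_image_sub_le_of_norm_hasDerivWithin_le (C := 0) hderiv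
    (fun _ _ => by simp) h0 ht
  simp only [zero_mul, norm_le_zero_iff] at h
  linarith

/-- If `x' = x ^ (1 - a)` and `x t > 0`, then `x ^ a` has derivative `a`. -/
theorem hasDerivAt_rpow_of_hasDerivAt_rpow_one_sub {x : ℝ → ℝ} {a t : ℝ} (hpos : 0 < x t)
    (hx : HasDerivAt x (x t ^ (1 - a)) t) : HasDerivAt (fun u => x u ^ a) a t := by
  convert hx.rpow_const (p := a) (Or.inl hpos.ne') using 1
  rw [mul_right_comm, ← Real.rpow_add hpos]
  simp

/-- **Explicit addition formula for `x' = x^{1/(n+1)}`.**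
Fix `n ≥ 1` and `x₀ > 0`.  If `x : I → ℝ` is a differentiable positive function on an
interval `I ∋ 0` with `x'(t) = x(t)^{1/(n+1)}` and `x(0) = x₀`, then for all `t, τ ∈ I`
with `t + τ ∈ I`,
`x(t+τ) = (x(t)^{n/(n+1)} − x₀^{n/(n+1)} + x(τ)^{n/(n+1)})^{(n+1)/n}`
(real powers of positive reals). -/
theorem addition_formula_root_ode (n : ℕ) (hn : 1 ≤ n) (x₀ : ℝ) (hx₀ : 0 < x₀)
    (I : Set ℝ) (hI : I.OrdConnected) (h0 : (0 : ℝ) ∈ I)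
    (x : ℝ → ℝ) (hpos : ∀ t ∈ I, 0 < x t)
    (hx : ∀ t ∈ I, HasDerivAt x (x t ^ ((1 : ℝ) / (n + 1))) t)
    (hx0 : x 0 = x₀) :
    ∀ t ∈ I, ∀ τ ∈ I, t + τ ∈ I →
      x (t + τ) =
        (x t ^ ((n : ℝ) / (n + 1)) - x₀ ^ ((n : ℝ) / (n + 1)) + x τ ^ ((n : ℝ) / (n + 1)))
          ^ (((n : ℝ) + 1) / n) := by
  intro t ht τ hτ htτ
  have hn0 : (n : ℝ) ≠ 0 := by positivity
  have hn1 : (n : ℝ) + 1 ≠ 0 := by positivity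
  have hexp : (1 : ℝ) / (n + 1) = 1 - (n : ℝ) / (n + 1) := by
    field_simp
    ring
  have hlin {u : ℝ} (hu : u ∈ I) :
      x u ^ ((n : ℝ) / (n + 1)) = x 0 ^ ((n : ℝ) / (n + 1)) + (n : ℝ) / (n + 1) * u :=
    eq_add_mul_of_hasDerivAt_const (y := fun u => x u ^ ((n : ℝ) / (n + 1))) hI h0
      (fun v hv => hasDerivAt_rpow_of_hasDerivAt_rpow_one_sub (hpos v hv) (hexp ▸ hx v hv)) hu
  have hadd : x t ^ ((n : ℝ) / (n + 1)) - x₀ ^ ((n : ℝ) / (n + 1)) + x τ ^ ((n : ℝ) / (n + 1)) =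
      x (t + τ) ^ ((n : ℝ) / (n + 1)) := by
    rw [← hx0, hlin ht, hlin hτ, hlin htτ]
    ring
  have hmul : (n : ℝ) / (n + 1) * (((n : ℝ) + 1) / n) = 1 := by
    field_simp
  rw [hadd, ← Real.rpow_mul (hpos _ htτ).le, hmul, Real.rpow_one]
end

section
/- Let f : ℝ → ℝ be of class C¹, let I ⊆ ℝ be an open interval containing 0, and let x : I → ℝ be differentiable with x'(t) = f(x(t)) for all t ∈ I and x(0) = x₀, where f(x₀) ≠ 0. Let R : J → ℝ be a C² function on an open set J containing x₀, satisfying the double-angle relation x(2t) = R(x(t)) for all t ∈ I with 2t ∈ I. Then the second derivative of R at x₀ is R''(x₀) = 2·f'(x₀)/f(x₀). -/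
open Filter Topology

/-- **Second Taylor coefficient of a double-angle formula: `R''(x₀) = 2 f'(x₀)/f(x₀)`.**
Let `f : ℝ → ℝ` be `C¹`, `I = (a,b)` an open interval containing `0`, and `x : I → ℝ`
differentiable with `x'(t) = f(x(t))` on `I`, `x(0) = x₀`, `f(x₀) ≠ 0`.  Let `R` be `C²`
on an open set `J ∋ x₀` with `x(2t) = R(x(t))` for all `t ∈ I` with `2t ∈ I`.
Then `R''(x₀) = 2·f'(x₀)/f(x₀)`. -/
theorem double_angle_deriv_two (f : ℝ → ℝ) (hf : ContDiff ℝ 1 f)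
    (a b : ℝ) (h0 : (0 : ℝ) ∈ Set.Ioo a b)
    (x : ℝ → ℝ) (x₀ : ℝ)
    (hx : ∀ t ∈ Set.Ioo a b, HasDerivAt x (f (x t)) t)
    (hx0 : x 0 = x₀) (hf0 : f x₀ ≠ 0)
    (J : Set ℝ) (hJ : IsOpen J) (hJx : x₀ ∈ J)
    (R : ℝ → ℝ) (hR : ContDiffOn ℝ 2 R J)
    (hrel : ∀ t ∈ Set.Ioo a b, 2 * t ∈ Set.Ioo a b → x (2 * t) = R (x t)) :
    deriv (deriv R) x₀ = 2 * deriv f x₀ / f x₀ := by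
  subst hx0
  have hI : ∀ᶠ t in 𝓝 (0 : ℝ), t ∈ Set.Ioo a b := Ioo_mem_nhds h0.1 h0.2
  have hdbl : Tendsto (fun t : ℝ => 2 * t) (𝓝 0) (𝓝 0) := by
    simpa using (continuous_const_mul (2 : ℝ)).tendsto 0
  have hx_zero := hx 0 h0
  have hxJ : ∀ᶠ t in 𝓝 (0 : ℝ), x t ∈ J :=
    hx_zero.continuousAt.eventually (hJ.mem_nhds hJx)
  have hRderiv : ∀ y ∈ J, HasDerivAt R (deriv R y) y := fun y hy =>
    ((hR.contDiffAt (hJ.mem_nhds hy)).differentiableAt (by norm_num)).hasDerivAt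
  have hR' : HasDerivAt (deriv R) (deriv (deriv R) (x 0)) (x 0) :=
    (((hR.deriv_of_isOpen (m := 1) hJ (by norm_num)).contDiffAt
      (hJ.mem_nhds hJx)).differentiableAt (by norm_num)).hasDerivAt
  have hf' : HasDerivAt f (deriv f (x 0)) (x 0) :=
    (hf.differentiable (by norm_num) _).hasDerivAt
  have hrel' : (fun t => x (2 * t)) =ᶠ[𝓝 0] fun t => R (x t) := by
    filter_upwards [hI, hdbl.eventually hI] with t ht ht2 using hrel t ht ht2
  have hode : (fun t => f (x (2 * t)) * 2) =ᶠ[𝓝 0] fun t => deriv R (x t) * f (x t) := by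
    filter_upwards [hI, hdbl.eventually hI, hxJ, hrel'.eventuallyEq_nhds] with t ht ht2 htJ heq
    have hleft : HasDerivAt (fun s => x (2 * s)) (f (x (2 * t)) * 2) t :=
      (hx _ ht2).comp t (by simpa using (hasDerivAt_id t).const_mul (2 : ℝ))
    exact (hleft.congr_of_eventuallyEq heq.symm).unique ((hRderiv _ htJ).comp t (hx t ht))
  have hR'x : deriv R (x 0) = 2 := by
    have h := hode.eq_of_nhds
    simp only [mul_zero] at h
    exact mul_right_cancel₀ hf0 (by linarith)
  have hx2 : HasDerivAt (fun s => x (2 * s)) (f (x 0) * 2) 0 :=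
    HasDerivAt.comp (h₂ := x) (h := fun s : ℝ => 2 * s) 0 (by simpa using hx_zero)
      (by simpa using (hasDerivAt_id (0 : ℝ)).const_mul (2 : ℝ))
  have hleft : HasDerivAt (fun t => f (x (2 * t)) * 2) (deriv f (x 0) * (f (x 0) * 2) * 2) 0 :=
    (HasDerivAt.comp (h₂ := f) (h := fun s : ℝ => x (2 * s)) 0 (by simpa using hf')
      hx2).mul_const 2
  have hright := (hR'.comp 0 hx_zero).mul (hf'.comp 0 hx_zero)
  have h := (hleft.congr_of_eventuallyEq hode.symm).unique hright
  simp only [Function.comp_apply, hR'x] at h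
  rw [eq_div_iff hf0]
  exact mul_right_cancel₀ hf0 (by linarith)
end

section
/- Let f : ℝ → ℝ be of class C², let I ⊆ ℝ be an open interval containing 0, and let x : I → ℝ be differentiable with x'(t) = f(x(t)) for all t ∈ I and x(0) = x₀, where f(x₀) ≠ 0. Let R : J → ℝ be a C³ function on an open set J containing x₀, satisfying the double-angle relation x(2t) = R(x(t)) for all t ∈ I with 2t ∈ I. Then the third derivative of R at x₀ is R'''(x₀) = 6·f''(x₀)/f(x₀). -/
open Filter Topology

/-- A solution of an autonomous equation `x' = f(x)` with `f` continuous and nonvanishing at the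
initial value maps neighbourhoods of the initial time onto neighbourhoods of the initial value. -/
theorem map_nhds_eq_of_autonomous_ode {f x : ℝ → ℝ} {t₀ : ℝ} (hf : Continuous f)
    (hx : ∀ᶠ t in 𝓝 t₀, HasDerivAt x (f (x t)) t) (hf0 : f (x t₀) ≠ 0) :
    map x (𝓝 t₀) = 𝓝 (x t₀) :=
  (hasStrictDerivAt_of_hasDerivAt_of_continuousAt hx
    (hf.continuousAt.comp hx.self_of_nhds.continuousAt)).map_nhds_eq hf0

/-- A double-angle formula `R` for a solution of `x' = f(x)` satisfies `2 f(R(y)) = R'(y) f(y)`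
for `y` near the initial value. -/
theorem double_angle_functional_equation {f x R : ℝ → ℝ} (hf : Continuous f)
    (hx : ∀ᶠ t in 𝓝 (0 : ℝ), HasDerivAt x (f (x t)) t) (hf0 : f (x 0) ≠ 0)
    (hR : ∀ᶠ y in 𝓝 (x 0), DifferentiableAt ℝ R y)
    (hrel : ∀ᶠ t in 𝓝 (0 : ℝ), x (2 * t) = R (x t)) :
    ∀ᶠ y in 𝓝 (x 0), 2 * f (R y) = deriv R y * f y := by
  rw [← map_nhds_eq_of_autonomous_ode hf hx hf0, eventually_map]
  have hdouble : Tendsto (fun t : ℝ => 2 * t) (𝓝 0) (𝓝 0) := by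
    simpa using (continuous_const_mul (2 : ℝ)).tendsto 0
  filter_upwards [hx, hdouble.eventually hx, hrel.eventually_nhds,
    hx.self_of_nhds.continuousAt.eventually hR] with t hxt hx2t hrelt hRt
  have hleft : HasDerivAt (fun s => x (2 * s)) (f (x (2 * t)) * 2) t := by
    simpa [Function.comp_def] using hx2t.comp t ((hasDerivAt_id t).const_mul 2)
  have hright : HasDerivAt (fun s => x (2 * s)) (deriv R (x t) * f (x t)) t :=
    (hRt.hasDerivAt.comp t hxt).congr_of_eventuallyEq hrelt
  rw [← hrelt.self_of_nhds, mul_comm]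
  exact hleft.unique hright

/-- The third derivative, at a fixed point `c` of `R` with `f c ≠ 0`, of a solution `R` of
`2 f(R(y)) = R'(y) f(y)`. -/
theorem deriv_three_of_functional_equation {f R : ℝ → ℝ} {c : ℝ} (hf : ContDiff ℝ 2 f)
    (hR : ContDiffAt ℝ 3 R c) (hRc : R c = c) (hf0 : f c ≠ 0)
    (h : ∀ᶠ y in 𝓝 c, 2 * f (R y) = deriv R y * f y) :
    deriv (deriv (deriv R)) c = 6 * deriv (deriv f) c / f c := by
  have hf1 (y : ℝ) : HasDerivAt f (deriv f y) y :=
    (hf.differentiable (by norm_num)).differentiableAt.hasDerivAt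
  have hf2 (y : ℝ) : HasDerivAt (deriv f) (deriv (deriv f) y) y :=
    (((contDiff_succ_iff_deriv (n := 1)).1 hf).2.2.differentiable
      (by norm_num)).differentiableAt.hasDerivAt
  have hR' : ContDiffAt ℝ 2 (deriv R) c := hR.derivWithin (by norm_num)
  have hR'' : ContDiffAt ℝ 1 (deriv (deriv R)) c := hR'.derivWithin (by norm_num)
  have hR1 : ∀ᶠ y in 𝓝 c, HasDerivAt R (deriv R y) y :=
    (hR.eventually (by simp)).mono fun y hy => (hy.differentiableAt (by norm_num)).hasDerivAt
  have hR2 : ∀ᶠ y in 𝓝 c, HasDerivAt (deriv R) (deriv (deriv R) y) y :=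
    (hR'.eventually (by simp)).mono fun y hy => (hy.differentiableAt (by norm_num)).hasDerivAt
  have hR3 := (hR''.differentiableAt (by norm_num)).hasDerivAt
  have h1 : ∀ᶠ y in 𝓝 c, 2 * (deriv f (R y) * deriv R y) =
      deriv (deriv R) y * f y + deriv R y * deriv f y := by
    filter_upwards [h.eventually_nhds, hR1, hR2] with y hy hy1 hy2
    exact (((hf1 (R y)).comp y hy1).const_mul 2).unique
      ((hy2.mul (hf1 y)).congr_of_eventuallyEq hy)
  have hc1 := hR1.self_of_nhds
  have hc2 := hR2.self_of_nhds
  have h2 := ((((hf2 (R c)).comp c hc1).mul hc2).const_mul 2).unique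
    (((hR3.mul (hf1 c)).add (hc2.mul (hf2 c))).congr_of_eventuallyEq h1)
  have hderiv : deriv R c = 2 := by
    have := h.self_of_nhds
    rw [hRc] at this
    exact (mul_right_cancel₀ hf0 this).symm
  simp only [Function.comp_apply, hRc, hderiv] at h2
  rw [eq_div_iff hf0]
  linarith

/-- **Third Taylor coefficient of a double-angle formula: `R'''(x₀) = 6 f''(x₀)/f(x₀)`.**
Let `f : ℝ → ℝ` be `C²`, `I = (a,b)` an open interval containing `0`, and `x : I → ℝ`
differentiable with `x'(t) = f(x(t))` on `I`, `x(0) = x₀`, `f(x₀) ≠ 0`.  Let `R` be `C³`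
on an open set `J ∋ x₀` with `x(2t) = R(x(t))` for all `t ∈ I` with `2t ∈ I`.
Then `R'''(x₀) = 6·f''(x₀)/f(x₀)`. -/
theorem double_angle_deriv_three (f : ℝ → ℝ) (hf : ContDiff ℝ 2 f)
    (a b : ℝ) (h0 : (0 : ℝ) ∈ Set.Ioo a b)
    (x : ℝ → ℝ) (x₀ : ℝ)
    (hx : ∀ t ∈ Set.Ioo a b, HasDerivAt x (f (x t)) t)
    (hx0 : x 0 = x₀) (hf0 : f x₀ ≠ 0)
    (J : Set ℝ) (hJ : IsOpen J) (hJx : x₀ ∈ J)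
    (R : ℝ → ℝ) (hR : ContDiffOn ℝ 3 R J)
    (hrel : ∀ t ∈ Set.Ioo a b, 2 * t ∈ Set.Ioo a b → x (2 * t) = R (x t)) :
    deriv (deriv (deriv R)) x₀ = 6 * deriv (deriv f) x₀ / f x₀ := by
  subst hx0
  have hI : ∀ᶠ t in 𝓝 (0 : ℝ), t ∈ Set.Ioo a b := isOpen_Ioo.mem_nhds h0
  have hdouble : Tendsto (fun t : ℝ => 2 * t) (𝓝 0) (𝓝 0) := by
    simpa using (continuous_const_mul (2 : ℝ)).tendsto 0
  have hRc : ContDiffAt ℝ 3 R (x 0) := hR.contDiffAt (hJ.mem_nhds hJx)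
  refine deriv_three_of_functional_equation hf hRc ?_ hf0
    (double_angle_functional_equation hf.continuous (hI.mono hx) hf0 ?_ ?_)
  · simpa using (hrel 0 h0 (by simpa using h0)).symm
  · exact (hRc.eventually (by simp)).mono fun y hy => hy.differentiableAt (by norm_num)
  · filter_upwards [hI, hdouble.eventually hI] with t ht h2t
    exact hrel t ht h2t
end
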